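/- arXiv:1802.08461 — 7 statements merged into one kernel-verified Lean document; each statement's English description precedes it below -/
import Mathlib

section
/- For all subspaces M, N of ℝ^d, if the distance satisfies d(M,N) < 1, then M and N have the same dimension: dim M = dim N. -/
open MeasureTheory Filter Submodule
open scoped RealInnerProductSpace

abbrev Euc (d : ℕ) := EuclideanSpace ℝ (Fin d)

/-- The orthogonal projection of `ℝ^d` onto the subspace `M`, as a map `ℝ^d →L ℝ^d`. -/
noncomputable def projL {d : ℕ} (M : Submodule ℝ (Euc d)) : Euc d →L[ℝ] Euc d :=
  M.subtypeL.comp (orthogonalProjection M)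

/-- The distance `d(M,N) = ‖P_M − P_N‖` between subspaces of `ℝ^d`. -/
noncomputable def subDist {d : ℕ} (M N : Submodule ℝ (Euc d)) : ℝ :=
  ‖projL M - projL N‖

theorem norm_projL_sub_projL_apply_of_mem {d : ℕ} {M N : Submodule ℝ (Euc d)} {x : Euc d}
    (hx : x ∈ M) (h0 : orthogonalProjectionOnto N x = 0) : ‖(projL M - projL N) x‖ = ‖x‖ := by
  have hM : (orthogonalProjectionOnto M x : Euc d) = x := starProjection_eq_self_iff.mpr hx
  simp [projL, h0, hM]

theorem finrank_le_of_subDist_lt_one {d : ℕ} {M N : Submodule ℝ (Euc d)}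
    (h : subDist M N < 1) : Module.finrank ℝ M ≤ Module.finrank ℝ N := by
  let f : M →ₗ[ℝ] N := (orthogonalProjectionOnto N).toLinearMap ∘ₗ M.subtype
  refine LinearMap.finrank_le_finrank_of_injective (f := f)
    ((injective_iff_map_eq_zero f).mpr fun x hx => ?_)
  by_contra hne
  have hpos : 0 < ‖(x : Euc d)‖ := norm_pos_iff.mpr (by simpa using hne)
  have hle := (projL M - projL N).le_opNorm (x : Euc d)
  rw [norm_projL_sub_projL_apply_of_mem x.2 hx] at hle
  exact hle.not_gt (mul_lt_of_lt_one_left hpos h)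

theorem subDist_comm {d : ℕ} (M N : Submodule ℝ (Euc d)) : subDist M N = subDist N M :=
  norm_sub_rev _ _

/-- If `d(M,N) < 1`, then `M` and `N` have the same dimension. -/
theorem finrank_eq_of_subDist_lt_one (d : ℕ) (M N : Submodule ℝ (Euc d))
    (h : subDist M N < 1) :
    Module.finrank ℝ M = Module.finrank ℝ N := by
  exact le_antisymm (finrank_le_of_subDist_lt_one h)
    (finrank_le_of_subDist_lt_one (subDist_comm M N ▸ h))
end

section
/- For all subspaces M, N of ℝ^d with dim M = dim N, the distance satisfies d(M,N) = 1 if and only if M ∩ N^⊥ ≠ {0}. -/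
open MeasureTheory Filter Submodule
open scoped RealInnerProductSpace

section StarProjection

variable {E : Type*} [NormedAddCommGroup E] [InnerProductSpace ℝ E]
  (M N : Submodule ℝ E) [M.HasOrthogonalProjection] [N.HasOrthogonalProjection]

theorem norm_sq_starProjection_sub_starProjection (x : E) :
    ‖M.starProjection x - N.starProjection x‖ ^ 2 =
      ‖M.starProjection (Nᗮ.starProjection x)‖ ^ 2 +
        ‖Mᗮ.starProjection (N.starProjection x)‖ ^ 2 := by
  have hM : M.starProjection (M.starProjection x - N.starProjection x) =
      M.starProjection (Nᗮ.starProjection x) := by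
    rw [starProjection_orthogonal_val, map_sub, map_sub,
      starProjection_eq_self_iff.mpr (starProjection_apply_mem M x)]
  have hMo : Mᗮ.starProjection (M.starProjection x - N.starProjection x) =
      -Mᗮ.starProjection (N.starProjection x) := by
    rw [map_sub, (starProjection_apply_eq_zero_iff _).mpr
      (M.le_orthogonal_orthogonal (starProjection_apply_mem M x)), zero_sub]
  rw [norm_sq_eq_add_norm_sq_starProjection _ M, hM, hMo, norm_neg]

theorem norm_starProjection_sub_starProjection_le (x : E) :
    ‖M.starProjection x - N.starProjection x‖ ≤ ‖x‖ := by
  refine le_of_sq_le_sq ?_ (norm_nonneg x)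
  rw [norm_sq_starProjection_sub_starProjection, norm_sq_eq_add_norm_sq_starProjection x N, add_comm]
  gcongr
  · exact norm_starProjection_apply_le _ _
  · exact norm_starProjection_apply_le _ _

variable {M N}

/-- A vector whose norm is preserved by `P_M - P_N` splits along `N ⊓ Mᗮ` and `M ⊓ Nᗮ`. -/
theorem starProjection_mem_of_norm_starProjection_sub_eq {x : E}
    (hx : ‖M.starProjection x - N.starProjection x‖ = ‖x‖) :
    N.starProjection x ∈ N ⊓ Mᗮ ∧ Nᗮ.starProjection x ∈ M ⊓ Nᗮ := by
  have hsq := norm_sq_starProjection_sub_starProjection M N x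
  rw [hx, norm_sq_eq_add_norm_sq_starProjection x N] at hsq
  have h₁ := norm_starProjection_apply_le M (Nᗮ.starProjection x)
  have h₂ := norm_starProjection_apply_le Mᗮ (N.starProjection x)
  have h₁' := pow_le_pow_left₀ (norm_nonneg _) h₁ 2
  have h₂' := pow_le_pow_left₀ (norm_nonneg _) h₂ 2
  refine ⟨⟨starProjection_apply_mem _ _, ?_⟩, ?_, starProjection_apply_mem _ _⟩
  · exact (mem_iff_norm_starProjection _ _).mpr
      (le_antisymm h₂ (le_of_sq_le_sq (by linarith) (norm_nonneg _)))
  · exact (mem_iff_norm_starProjection _ _).mpr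
      (le_antisymm h₁ (le_of_sq_le_sq (by linarith) (norm_nonneg _)))

end StarProjection

theorem inf_orthogonal_eq_bot_of_finrank_eq {E : Type*} [NormedAddCommGroup E]
    [InnerProductSpace ℝ E] {M N : Submodule ℝ E} [FiniteDimensional ℝ M] [FiniteDimensional ℝ N]
    (h : Module.finrank ℝ M = Module.finrank ℝ N) (hMN : M ⊓ Nᗮ = ⊥) : N ⊓ Mᗮ = ⊥ := by
  let f : M →ₗ[ℝ] N := (N.orthogonalProjectionOnto : E →ₗ[ℝ] N) ∘ₗ M.subtype
  have hf : Function.Injective f := by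
    rw [← LinearMap.ker_eq_bot, LinearMap.ker_eq_bot']
    intro m hm
    have hmem : (m : E) ∈ M ⊓ Nᗮ := ⟨m.2, orthogonalProjectionOnto_eq_zero_iff.mp hm⟩
    rw [hMN, Submodule.mem_bot] at hmem
    exact Subtype.ext hmem
  have hsurj := (LinearMap.injective_iff_surjective_of_finrank_eq_finrank h).mp hf
  rw [eq_bot_iff]
  rintro y ⟨hyN, hyM⟩
  obtain ⟨m, hm⟩ := hsurj ⟨y, hyN⟩
  have hy : N.starProjection (m : E) = y := congrArg Subtype.val hm
  have h0 : ⟪y, y⟫ = 0 := by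
    calc ⟪y, y⟫ = ⟪N.starProjection (m : E), y⟫ := by rw [hy]
      _ = ⟪(m : E), y⟫ := by
        rw [inner_starProjection_left_eq_right, starProjection_eq_self_iff.mpr hyN]
      _ = 0 := inner_right_of_mem_orthogonal m.2 hyM
  exact inner_self_eq_zero.mp h0

theorem ContinuousLinearMap.exists_norm_le_one_norm_apply_eq_norm {E F : Type*}
    [NormedAddCommGroup E] [NormedSpace ℝ E] [FiniteDimensional ℝ E]
    [NormedAddCommGroup F] [NormedSpace ℝ F] (T : E →L[ℝ] F) :
    ∃ x, ‖x‖ ≤ 1 ∧ ‖T x‖ = ‖T‖ := by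
  have := FiniteDimensional.proper ℝ E
  obtain ⟨x, hx, hsup⟩ := (isCompact_closedBall (0 : E) 1).exists_sSup_image_eq
    (Metric.nonempty_closedBall.mpr zero_le_one) (f := fun x => ‖T x‖) (by fun_prop)
  exact ⟨x, mem_closedBall_zero_iff.mp hx, by
    rw [← T.sSup_unitClosedBall_eq_norm]; exact hsup.symm⟩

/-- If `dim M = dim N`, then `d(M,N) = 1` if and only if `M ∩ N^⊥ ≠ {0}`. -/
theorem subDist_eq_one_iff (d : ℕ) (M N : Submodule ℝ (Euc d))
    (h : Module.finrank ℝ M = Module.finrank ℝ N) :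
    subDist M N = 1 ↔ M ⊓ Nᗮ ≠ ⊥ := by
  change ‖M.starProjection - N.starProjection‖ = 1 ↔ _
  constructor
  · intro hT hbot
    obtain ⟨x, hx, hTx⟩ :=
      (M.starProjection - N.starProjection).exists_norm_le_one_norm_apply_eq_norm
    rw [hT, sub_apply] at hTx
    have hle := norm_starProjection_sub_starProjection_le M N x
    obtain ⟨h₁, h₂⟩ := starProjection_mem_of_norm_starProjection_sub_eq
      (le_antisymm hle (hx.trans_eq hTx.symm))
    rw [inf_orthogonal_eq_bot_of_finrank_eq h hbot, Submodule.mem_bot] at h₁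
    rw [hbot, Submodule.mem_bot, starProjection_orthogonal_val, h₁, sub_zero] at h₂
    simp [h₂] at hTx
  · intro hne
    obtain ⟨x, ⟨hxM, hxN⟩, hx0⟩ := exists_mem_ne_zero_of_ne_bot hne
    refine le_antisymm (ContinuousLinearMap.opNorm_le_bound _ zero_le_one fun y => ?_) ?_
    · simpa using norm_starProjection_sub_starProjection_le M N y
    · have hle := (M.starProjection - N.starProjection).le_opNorm x
      rw [sub_apply, starProjection_eq_self_iff.mpr hxM,
        (starProjection_apply_eq_zero_iff _).mpr hxN, sub_zero] at hle
      exact (le_mul_iff_one_le_left (norm_pos_iff.mpr hx0)).mp hle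
end

section
/- For every invertible linear map A ∈ GL(d,ℝ) and all subspaces M, N of ℝ^d, the induced transformation on subspaces is Lipschitz: d(A(M), A(N)) ≤ ‖A‖·‖A^{-1}‖·d(M,N). -/
open MeasureTheory Filter Submodule
open scoped RealInnerProductSpace

/-- The orthogonal projection onto `M` does not move a point further than any point of `M`
is away from it. -/
theorem norm_sub_starProjection_le {E : Type*} [NormedAddCommGroup E] [InnerProductSpace ℝ E]
    (M : Submodule ℝ E) [M.HasOrthogonalProjection] (x : E) {m : E} (hm : m ∈ M) :
    ‖x - M.starProjection x‖ ≤ ‖x - m‖ := by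
  rw [M.starProjection_minimal]
  exact ciInf_le ⟨0, by rintro _ ⟨y, rfl⟩; exact norm_nonneg _⟩ (⟨m, hm⟩ : M)

/-- If the orthogonal projection onto `N` moves points of `M` by at most a factor `c` of their
norm, then the orthogonal projection onto `M` has norm at most `c` on `Nᗮ`. -/
theorem norm_starProjection_le_of_mem_orthogonal {E : Type*} [NormedAddCommGroup E]
    [InnerProductSpace ℝ E] (M N : Submodule ℝ E) [M.HasOrthogonalProjection]
    [N.HasOrthogonalProjection] {c : ℝ} (hc : 0 ≤ c)
    (h : ∀ m ∈ M, ‖m - N.starProjection m‖ ≤ c * ‖m‖) {w : E} (hw : w ∈ Nᗮ) : ‖M.starProjection w‖ ≤ c * ‖w‖ := by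
  set p := M.starProjection w with hp
  have hpM : p ∈ M := M.starProjection_apply_mem w
  have h₁ : ⟪w - p, p⟫ = 0 := M.starProjection_inner_eq_zero w p hpM
  have h₂ : ⟪w, N.starProjection p⟫ = 0 :=
    N.inner_left_of_mem_orthogonal (N.starProjection_apply_mem p) hw
  have h₃ : ‖p‖ * ‖p‖ = ⟪w, p - N.starProjection p⟫ := by
    rw [inner_sub_left] at h₁
    rw [inner_sub_right, h₂, ← real_inner_self_eq_norm_mul_norm]
    linarith
  have h₄ : ‖p‖ * ‖p‖ ≤ c * ‖w‖ * ‖p‖ := by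
    rw [h₃]
    calc ⟪w, p - N.starProjection p⟫ ≤ ‖w‖ * ‖p - N.starProjection p‖ := real_inner_le_norm _ _
      _ ≤ ‖w‖ * (c * ‖p‖) := by gcongr; exact h p hpM
      _ = c * ‖w‖ * ‖p‖ := by ring
  rcases (norm_nonneg p).eq_or_lt with h₀ | h₀
  · rw [← h₀]
    positivity
  · exact le_of_mul_le_mul_right h₄ h₀

/-- A bound for the gap between two subspaces from the two one-sided gaps. -/
theorem norm_starProjection_sub_le {E : Type*} [NormedAddCommGroup E] [InnerProductSpace ℝ E]
    (M N : Submodule ℝ E) [M.HasOrthogonalProjection] [N.HasOrthogonalProjection] {c : ℝ}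
    (hc : 0 ≤ c) (hM : ∀ m ∈ M, ‖m - N.starProjection m‖ ≤ c * ‖m‖)
    (hN : ∀ n ∈ N, ‖n - M.starProjection n‖ ≤ c * ‖n‖) :
    ‖M.starProjection - N.starProjection‖ ≤ c := by
  refine ContinuousLinearMap.opNorm_le_bound _ hc fun x => ?_
  set q := N.starProjection x with hq
  set w := x - q with hw
  have hqN : q ∈ N := N.starProjection_apply_mem x
  have hwN : w ∈ Nᗮ := N.sub_starProjection_mem_orthogonal x
  have hx : x = q + w := by rw [hw]; abel
  have hsplit : (M.starProjection - N.starProjection) x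
      = M.starProjection w - (q - M.starProjection q) := by
    rw [sub_apply, ← hq, hw, map_sub]
    abel
  have horth : ⟪M.starProjection w, q - M.starProjection q⟫ = 0 :=
    M.inner_right_of_mem_orthogonal (M.starProjection_apply_mem w)
      (M.sub_starProjection_mem_orthogonal q)
  have hpyth := norm_sub_sq_eq_norm_sq_add_norm_sq_real horth
  have hxpyth : ‖x‖ * ‖x‖ = ‖q‖ * ‖q‖ + ‖w‖ * ‖w‖ := by
    conv_lhs => rw [hx]
    exact norm_add_sq_eq_norm_sq_add_norm_sq_real (N.inner_right_of_mem_orthogonal hqN hwN)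
  have h₁ := norm_starProjection_le_of_mem_orthogonal M N hc hM hwN
  have h₂ := hN q hqN
  rw [hsplit]
  refine abs_le_of_sq_le_sq' ?_ (by positivity) |>.2
  have h₃ := mul_self_le_mul_self (norm_nonneg _) h₁
  have h₄ := mul_self_le_mul_self (norm_nonneg _) h₂
  calc _ = ‖M.starProjection w‖ * ‖M.starProjection w‖
        + ‖q - M.starProjection q‖ * ‖q - M.starProjection q‖ := by rw [sq, hpyth]
    _ ≤ c * ‖w‖ * (c * ‖w‖) + c * ‖q‖ * (c * ‖q‖) := add_le_add h₃ h₄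
    _ = c ^ 2 * (‖x‖ * ‖x‖) := by rw [hxpyth]; ring
    _ = (c * ‖x‖) ^ 2 := by ring

/-- The one-sided gap between two subspaces grows at most by the factor `‖A‖ ‖A⁻¹‖` under an
invertible linear map `A`. -/
theorem norm_sub_starProjection_map_le {E F : Type*} [NormedAddCommGroup E]
    [InnerProductSpace ℝ E] [NormedAddCommGroup F] [InnerProductSpace ℝ F] (A : E ≃L[ℝ] F)
    (M N : Submodule ℝ E) [M.HasOrthogonalProjection] [N.HasOrthogonalProjection]
    [(M.map ((A : E →L[ℝ] F) : E →ₗ[ℝ] F)).HasOrthogonalProjection] {y : F}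
    (hy : y ∈ N.map ((A : E →L[ℝ] F) : E →ₗ[ℝ] F)) :
    ‖y - (M.map ((A : E →L[ℝ] F) : E →ₗ[ℝ] F)).starProjection y‖
      ≤ ‖(A : E →L[ℝ] F)‖ * ‖(A.symm : F →L[ℝ] E)‖
          * ‖M.starProjection - N.starProjection‖ * ‖y‖ := by
  obtain ⟨n, hn, rfl⟩ := hy
  have hdiff : n - M.starProjection n = -((M.starProjection - N.starProjection) n) := by
    rw [sub_apply, N.starProjection_eq_self_iff.mpr hn, neg_sub]
  have hnorm : ‖n‖ ≤ ‖(A.symm : F →L[ℝ] E)‖ * ‖A n‖ := by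
    simpa using (A.symm : F →L[ℝ] E).le_opNorm (A n)
  calc _ ≤ ‖(A : E →L[ℝ] F) n - (A : E →L[ℝ] F) (M.starProjection n)‖ :=
        norm_sub_starProjection_le _ _
          (Submodule.mem_map_of_mem (M.starProjection_apply_mem n))
    _ = ‖(A : E →L[ℝ] F) (n - M.starProjection n)‖ := by rw [map_sub]
    _ ≤ ‖(A : E →L[ℝ] F)‖ * ‖n - M.starProjection n‖ := ContinuousLinearMap.le_opNorm _ _
    _ ≤ ‖(A : E →L[ℝ] F)‖ * (‖M.starProjection - N.starProjection‖
          * (‖(A.symm : F →L[ℝ] E)‖ * ‖A n‖)) := by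
        rw [hdiff, norm_neg]
        gcongr
        exact ContinuousLinearMap.le_opNorm_of_le _ hnorm
    _ = _ := by simp only [ContinuousLinearMap.coe_coe, ContinuousLinearEquiv.coe_coe]; ring

theorem subDist_eq_norm_starProjection_sub {d : ℕ} (M N : Submodule ℝ (Euc d)) :
    subDist M N = ‖M.starProjection - N.starProjection‖ :=
  rfl

/-- For every invertible linear map `A` of `ℝ^d`, the induced transformation on
subspaces is Lipschitz: `d(A(M), A(N)) ≤ ‖A‖ ‖A⁻¹‖ d(M,N)`. -/
theorem subDist_map_le (d : ℕ) (A : Euc d ≃L[ℝ] Euc d) (M N : Submodule ℝ (Euc d)) :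
    subDist (M.map ((A : Euc d →L[ℝ] Euc d) : Euc d →ₗ[ℝ] Euc d))
        (N.map ((A : Euc d →L[ℝ] Euc d) : Euc d →ₗ[ℝ] Euc d))
      ≤ ‖(A : Euc d →L[ℝ] Euc d)‖ * ‖(A.symm : Euc d →L[ℝ] Euc d)‖ * subDist M N := by
  simp only [subDist_eq_norm_starProjection_sub]
  refine norm_starProjection_sub_le _ _ (by positivity) (fun y hy => ?_)
    fun y hy => norm_sub_starProjection_map_le A M N hy
  rw [norm_sub_rev M.starProjection]
  exact norm_sub_starProjection_map_le A N M hy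
end

section
/- For all subspaces M, N of ℝ^d, the cosine of the angle between M and N equals ‖P_M P_N − P_{M∩N}‖: c(M,N) = ‖P_M P_N − P_{M∩N}‖, where P_{M∩N} is the orthogonal projection onto M ∩ N. -/
open MeasureTheory Filter Submodule
open scoped RealInnerProductSpace

/-- The cosine of the minimal angle between subspaces `M` and `N` of `ℝ^d`
(`sSup ∅ = 0` in `ℝ`, matching the convention `max ∅ = 0`). -/
noncomputable def c0 {d : ℕ} (M N : Submodule ℝ (Euc d)) : ℝ :=
  sSup {r : ℝ | ∃ x ∈ M, ∃ y ∈ N, x ≠ 0 ∧ y ≠ 0 ∧ r = |⟪x, y⟫| / (‖x‖ * ‖y‖)}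

/-- The cosine of the angle between subspaces `M` and `N` of `ℝ^d`. -/
noncomputable def angleCos {d : ℕ} (M N : Submodule ℝ (Euc d)) : ℝ :=
  c0 (M ⊓ (M ⊓ N)ᗮ) (N ⊓ (M ⊓ N)ᗮ)

theorem starProjection_inf_orthogonal_of_le {E : Type*} [NormedAddCommGroup E]
    [InnerProductSpace ℝ E] {L M : Submodule ℝ E} [L.HasOrthogonalProjection]
    [M.HasOrthogonalProjection] [(M ⊓ Lᗮ).HasOrthogonalProjection] (h : L ≤ M) :
    (M ⊓ Lᗮ).starProjection = M.starProjection - L.starProjection := by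
  ext u
  refine eq_starProjection_of_mem_orthogonal ⟨?_, ?_⟩ ?_
  · exact M.sub_mem (starProjection_apply_mem M u) (h (starProjection_apply_mem L u))
  · have key := Lᗮ.sub_mem (sub_starProjection_mem_orthogonal (K := L) u)
      (orthogonal_le h (sub_starProjection_mem_orthogonal (K := M) u))
    rwa [sub_sub_sub_cancel_left] at key
  · have hM := orthogonal_le (inf_le_left : M ⊓ Lᗮ ≤ M)
      (sub_starProjection_mem_orthogonal (K := M) u)
    have hL : L.starProjection u ∈ (M ⊓ Lᗮ)ᗮ :=
      orthogonal_le inf_le_right (le_orthogonal_orthogonal L (starProjection_apply_mem L u))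
    have key := add_mem hM hL
    rwa [sub_add] at key

theorem projL_eq_starProjection {d : ℕ} (M : Submodule ℝ (Euc d)) :
    projL M = M.starProjection := rfl

theorem abs_inner_le_norm_projL_comp {d : ℕ} {M N : Submodule ℝ (Euc d)} {x y : Euc d}
    (hx : x ∈ M) (hy : y ∈ N) :
    |⟪x, y⟫| ≤ ‖projL M ∘L projL N‖ * (‖x‖ * ‖y‖) := by
  have hxy : ⟪x, y⟫ = ⟪x, (projL M ∘L projL N) y⟫ := by
    rw [ContinuousLinearMap.comp_apply, projL_eq_starProjection, projL_eq_starProjection,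
      starProjection_eq_self_iff.2 hy, ← inner_starProjection_left_eq_right,
      starProjection_eq_self_iff.2 hx]
  calc |⟪x, y⟫| ≤ ‖x‖ * ‖(projL M ∘L projL N) y‖ := hxy ▸ abs_real_inner_le_norm _ _
    _ ≤ ‖x‖ * (‖projL M ∘L projL N‖ * ‖y‖) := by
      gcongr
      exact ContinuousLinearMap.le_opNorm _ _
    _ = _ := by ring

/-- The cosine of the minimal angle satisfies `c₀(M,N) = ‖P_M P_N‖`. -/
theorem c0_eq_norm {d : ℕ} (M N : Submodule ℝ (Euc d)) :
    c0 M N = ‖projL M ∘L projL N‖ := by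
  have hub : ∀ r ∈ {r : ℝ | ∃ x ∈ M, ∃ y ∈ N, x ≠ 0 ∧ y ≠ 0 ∧ r = |⟪x, y⟫| / (‖x‖ * ‖y‖)},
      r ≤ ‖projL M ∘L projL N‖ := by
    rintro _ ⟨x, hx, y, hy, hx0, hy0, rfl⟩
    rw [div_le_iff₀ (mul_pos (norm_pos_iff.2 hx0) (norm_pos_iff.2 hy0))]
    exact abs_inner_le_norm_projL_comp hx hy
  have hnonneg : 0 ≤ c0 M N := by
    refine Real.sSup_nonneg ?_
    rintro _ ⟨x, -, y, -, -, -, rfl⟩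
    positivity
  refine le_antisymm (Real.sSup_le hub (norm_nonneg _))
    (ContinuousLinearMap.opNorm_le_bound _ hnonneg fun z => ?_)
  rw [ContinuousLinearMap.comp_apply, projL_eq_starProjection, projL_eq_starProjection]
  set y := N.starProjection z with hy
  set x := M.starProjection y with hx
  have hyz : ‖y‖ ≤ ‖z‖ := norm_starProjection_apply_le N z
  by_cases hx0 : x = 0
  · rw [hx0, norm_zero]
    positivity
  have hy0 : y ≠ 0 := by
    intro h
    exact hx0 (by rw [hx, h, map_zero])
  have hinner : ⟪x, y⟫ = ‖x‖ * ‖x‖ := by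
    have hsymm := inner_starProjection_left_eq_right M x y
    rw [starProjection_eq_self_iff.2 (starProjection_apply_mem M y), ← hx] at hsymm
    rw [hsymm, real_inner_self_eq_norm_mul_norm]
  have hxy : |⟪x, y⟫| / (‖x‖ * ‖y‖) ≤ c0 M N :=
    le_csSup ⟨_, hub⟩ ⟨x, starProjection_apply_mem M y, y, starProjection_apply_mem N z,
      hx0, hy0, rfl⟩
  rw [hinner, abs_mul_self, mul_div_mul_left _ _ (norm_ne_zero_iff.2 hx0),
    div_le_iff₀ (norm_pos_iff.2 hy0)] at hxy
  exact hxy.trans (by gcongr)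

/-- The cosine of the angle satisfies `c(M,N) = ‖P_M P_N − P_{M∩N}‖`. -/
theorem angleCos_eq_norm (d : ℕ) (M N : Submodule ℝ (Euc d)) :
    angleCos M N = ‖projL M ∘L projL N - projL (M ⊓ N)‖ := by
  have hPM : projL (M ⊓ (M ⊓ N)ᗮ) = projL M - projL (M ⊓ N) :=
    starProjection_inf_orthogonal_of_le inf_le_left
  have hPN : projL (N ⊓ (M ⊓ N)ᗮ) = projL N - projL (M ⊓ N) :=
    starProjection_inf_orthogonal_of_le inf_le_right
  rw [angleCos, c0_eq_norm, hPM, hPN]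
  congr 1
  ext1 u
  have hM : M.starProjection ((M ⊓ N).starProjection u) = (M ⊓ N).starProjection u :=
    starProjection_eq_self_iff.2 (starProjection_apply_mem (M ⊓ N) u).1
  have hN : (M ⊓ N).starProjection (N.starProjection u) = (M ⊓ N).starProjection u := by
    rw [← ContinuousLinearMap.comp_apply,
      starProjection_comp_starProjection_of_le (inf_le_right : M ⊓ N ≤ N)]
  have hL : (M ⊓ N).starProjection ((M ⊓ N).starProjection u) = (M ⊓ N).starProjection u :=
    starProjection_eq_self_iff.2 (starProjection_apply_mem (M ⊓ N) u)
  simp only [projL_eq_starProjection, ContinuousLinearMap.comp_apply,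
    sub_apply, map_sub, hM, hN, hL]
  abel
end

section
/- For all subspaces M, N of ℝ^d, the cosine of the angle between M and N is strictly less than one: c(M,N) < 1. -/
open MeasureTheory Filter Submodule
open scoped RealInnerProductSpace

/-- The cosine of the minimal angle between subspaces meeting only in zero is less than one. -/
theorem c0_lt_one_of_disjoint {d : ℕ} {M N : Submodule ℝ (Euc d)} (h : Disjoint M N) :
    c0 M N < 1 := by
  unfold c0
  set S := {r : ℝ | ∃ x ∈ M, ∃ y ∈ N, x ≠ 0 ∧ y ≠ 0 ∧ r = |⟪x, y⟫| / (‖x‖ * ‖y‖)}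
  have hS_image : S = (fun p : Euc d × Euc d => |⟪p.1, p.2⟫|) ''
      ((Metric.sphere 0 1 ∩ M) ×ˢ (Metric.sphere 0 1 ∩ N)) := by
    ext r
    constructor
    · rintro ⟨x, hx, y, hy, hx0, hy0, rfl⟩
      refine ⟨(‖x‖⁻¹ • x, ‖y‖⁻¹ • y), ⟨⟨?_, M.smul_mem _ hx⟩, ⟨?_, N.smul_mem _ hy⟩⟩, ?_⟩
      · simp [norm_smul, hx0]
      · simp [norm_smul, hy0]
      · simp only [real_inner_smul_left, real_inner_smul_right, abs_mul, abs_inv, abs_norm]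
        field_simp
    · rintro ⟨⟨x, y⟩, ⟨⟨hx1, hx⟩, ⟨hy1, hy⟩⟩, rfl⟩
      have hx1 : ‖x‖ = 1 := by simpa using hx1
      have hy1 : ‖y‖ = 1 := by simpa using hy1
      refine ⟨x, hx, y, hy, ?_, ?_, by simp [hx1, hy1]⟩
      · exact norm_ne_zero_iff.mp (by simp [hx1])
      · exact norm_ne_zero_iff.mp (by simp [hy1])
  rcases S.eq_empty_or_nonempty with hempty | hne
  · simp [hempty]
  · have hcompact : IsCompact S := by
      rw [hS_image]
      refine IsCompact.image ?_ (by fun_prop)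
      exact ((isCompact_sphere 0 1).inter_right M.closed_of_finiteDimensional).prod
        ((isCompact_sphere 0 1).inter_right N.closed_of_finiteDimensional)
    obtain ⟨x, hx, y, hy, hx0, hy0, hmax⟩ := hcompact.sSup_mem hne
    rw [hmax]
    refine lt_of_le_of_ne ?_ fun heq => ?_
    · exact div_le_one_of_le₀ (abs_real_inner_le_norm x y) (by positivity)
    · have hone : |⟪x, y⟫ / (‖x‖ * ‖y‖)| = 1 := by
        rwa [abs_div, abs_of_nonneg (by positivity : 0 ≤ ‖x‖ * ‖y‖)]
      obtain ⟨-, r, -, rfl⟩ := (abs_real_inner_div_norm_mul_norm_eq_one_iff x y).mp hone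
      exact hy0 (Submodule.disjoint_def.mp h _ (M.smul_mem r hx) hy)

theorem disjoint_inf_orthogonal_inf {d : ℕ} (M N : Submodule ℝ (Euc d)) :
    Disjoint (M ⊓ (M ⊓ N)ᗮ) (N ⊓ (M ⊓ N)ᗮ) := by
  rw [Submodule.disjoint_def]
  rintro x ⟨hxM, hx⟩ ⟨hxN, -⟩
  exact Submodule.disjoint_def.mp (M ⊓ N).orthogonal_disjoint x ⟨hxM, hxN⟩ hx

/-- The cosine of the angle between two subspaces is strictly less than one. -/
theorem angleCos_lt_one (d : ℕ) (M N : Submodule ℝ (Euc d)) : angleCos M N < 1 :=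
  c0_lt_one_of_disjoint (disjoint_inf_orthogonal_inf M N)
end

section
/- For all subspaces M, N of ℝ^d and every k ∈ ℕ with k ≥ 1, the alternating projections satisfy ‖(P_M P_N)^k − P_{M∩N}‖ ≤ c(M,N)^{2k−1}, where P_{M∩N} is the orthogonal projection onto M ∩ N. -/
open MeasureTheory Filter Submodule
open scoped RealInnerProductSpace

theorem c0_nonneg {d : ℕ} (M N : Submodule ℝ (Euc d)) : 0 ≤ c0 M N := by
  apply Real.sSup_nonneg
  rintro r ⟨x, -, y, -, -, -, rfl⟩
  positivity

theorem abs_inner_le_c0 {d : ℕ} {M N : Submodule ℝ (Euc d)} {x y : Euc d}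
    (hx : x ∈ M) (hy : y ∈ N) : |⟪x, y⟫| ≤ c0 M N * (‖x‖ * ‖y‖) := by
  rcases eq_or_ne x 0 with rfl | hx0
  · simp
  rcases eq_or_ne y 0 with rfl | hy0
  · simp
  have hpos : 0 < ‖x‖ * ‖y‖ := mul_pos (norm_pos_iff.2 hx0) (norm_pos_iff.2 hy0)
  rw [← div_le_iff₀ hpos]
  refine le_csSup ⟨1, ?_⟩ ⟨x, hx, y, hy, hx0, hy0, rfl⟩
  rintro r ⟨a, -, b, -, -, -, rfl⟩
  exact div_le_one_of_le₀ (abs_real_inner_le_norm a b) (by positivity)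

theorem c0_comm {d : ℕ} (M N : Submodule ℝ (Euc d)) : c0 M N = c0 N M := by
  unfold c0
  congr 1
  ext r
  constructor <;>
  · rintro ⟨x, hx, y, hy, hx0, hy0, rfl⟩
    exact ⟨y, hy, x, hx, hy0, hx0, by rw [real_inner_comm, mul_comm]⟩

theorem angleCos_comm {d : ℕ} (M N : Submodule ℝ (Euc d)) : angleCos M N = angleCos N M := by
  unfold angleCos
  rw [c0_comm, inf_comm M N]

theorem starProjection_mem_orthogonal_of_le {d : ℕ} {W N : Submodule ℝ (Euc d)} (h : W ≤ N)
    {x : Euc d} (hx : x ∈ Wᗮ) : N.starProjection x ∈ Wᗮ := by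
  intro w hw
  rw [← Submodule.inner_starProjection_left_eq_right,
    Submodule.starProjection_eq_self_iff.2 (h hw)]
  exact hx w hw

theorem norm_starProjection_le_angleCos {d : ℕ} {M N : Submodule ℝ (Euc d)} {x : Euc d}
    (hx : x ∈ M ⊓ (M ⊓ N)ᗮ) : ‖N.starProjection x‖ ≤ angleCos M N * ‖x‖ := by
  have hy : N.starProjection x ∈ N ⊓ (M ⊓ N)ᗮ :=
    ⟨N.starProjection_apply_mem x, starProjection_mem_orthogonal_of_le inf_le_right hx.2⟩
  have hsq : ⟪x, N.starProjection x⟫ = ‖N.starProjection x‖ ^ 2 := by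
    have h := N.starProjection_inner_eq_zero x _ (N.starProjection_apply_mem x)
    rw [inner_sub_left, sub_eq_zero] at h
    rw [h, real_inner_self_eq_norm_sq]
  have hle : ‖N.starProjection x‖ ^ 2 ≤ angleCos M N * (‖x‖ * ‖N.starProjection x‖) :=
    hsq ▸ (le_abs_self _).trans (abs_inner_le_c0 hx hy)
  rcases (norm_nonneg (N.starProjection x)).eq_or_lt with h0 | hpos
  · rw [← h0]
    exact mul_nonneg (c0_nonneg _ _) (norm_nonneg _)
  · exact le_of_mul_le_mul_right (by linarith) hpos

theorem norm_starProjection_le_angleCos' {d : ℕ} {M N : Submodule ℝ (Euc d)} {x : Euc d}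
    (hx : x ∈ N ⊓ (M ⊓ N)ᗮ) : ‖M.starProjection x‖ ≤ angleCos M N * ‖x‖ := by
  rw [angleCos_comm]
  exact norm_starProjection_le_angleCos (by rwa [inf_comm N M])

/-- Iterates of `P_M P_N` on the orthogonal complement of `M ⊓ N` stay in `M ⊓ (M ⊓ N)ᗮ` and
contract geometrically. -/
theorem alternating_pow_succ_apply {d : ℕ} (M N : Submodule ℝ (Euc d)) {u : Euc d}
    (hu : u ∈ (M ⊓ N)ᗮ) (n : ℕ) :
    ((M.starProjection ∘L N.starProjection) ^ (n + 1)) u ∈ M ⊓ (M ⊓ N)ᗮ ∧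
      ‖((M.starProjection ∘L N.starProjection) ^ (n + 1)) u‖ ≤
        angleCos M N ^ (2 * n + 1) * ‖u‖ := by
  have hc : 0 ≤ angleCos M N := c0_nonneg _ _
  have hmemN {x : Euc d} (hx : x ∈ (M ⊓ N)ᗮ) : N.starProjection x ∈ N ⊓ (M ⊓ N)ᗮ :=
    ⟨N.starProjection_apply_mem x, starProjection_mem_orthogonal_of_le inf_le_right hx⟩
  have hmem {x : Euc d} (hx : x ∈ (M ⊓ N)ᗮ) :
      M.starProjection (N.starProjection x) ∈ M ⊓ (M ⊓ N)ᗮ :=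
    ⟨M.starProjection_apply_mem _, starProjection_mem_orthogonal_of_le inf_le_left (hmemN hx).2⟩
  induction n with
  | zero =>
    simp only [zero_add, pow_one, mul_zero, ContinuousLinearMap.comp_apply]
    refine ⟨hmem hu, (norm_starProjection_le_angleCos' (hmemN hu)).trans ?_⟩
    gcongr
    exact N.norm_starProjection_apply_le u
  | succ n ih =>
    rw [pow_succ', mul_apply_eq_comp, ContinuousLinearMap.comp_apply]
    refine ⟨hmem ih.1.2, (norm_starProjection_le_angleCos' (hmemN ih.1.2)).trans ?_⟩
    calc angleCos M N * ‖N.starProjection _‖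
        ≤ angleCos M N * (angleCos M N * (angleCos M N ^ (2 * n + 1) * ‖u‖)) := by
          gcongr
          exact (norm_starProjection_le_angleCos ih.1).trans (by gcongr; exact ih.2)
      _ = angleCos M N ^ (2 * (n + 1) + 1) * ‖u‖ := by ring

theorem alternating_pow_apply_of_mem {d : ℕ} {M N : Submodule ℝ (Euc d)} {w : Euc d}
    (hw : w ∈ M ⊓ N) (n : ℕ) : ((M.starProjection ∘L N.starProjection) ^ n) w = w := by
  induction n with
  | zero => simp
  | succ n ih =>
    rw [pow_succ', mul_apply_eq_comp, ih, ContinuousLinearMap.comp_apply,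
      Submodule.starProjection_eq_self_iff.2 hw.2, Submodule.starProjection_eq_self_iff.2 hw.1]

/-- Speed of convergence of the method of alternating projections:
`‖(P_M P_N)^k − P_{M∩N}‖ ≤ c(M,N)^{2k−1}` for all `k ≥ 1`. -/
theorem alternating_projections_estimate (d : ℕ) (M N : Submodule ℝ (Euc d))
    (k : ℕ) (hk : 1 ≤ k) :
    ‖(projL M ∘L projL N) ^ k - projL (M ⊓ N)‖ ≤ angleCos M N ^ (2 * k - 1) := by
  obtain ⟨n, rfl⟩ := Nat.exists_eq_add_of_le' hk
  have hc : 0 ≤ angleCos M N := c0_nonneg _ _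
  simp only [projL_eq_starProjection]
  rw [show 2 * (n + 1) - 1 = 2 * n + 1 by omega]
  refine ContinuousLinearMap.opNorm_le_bound _ (pow_nonneg hc _) fun v => ?_
  have hw := (M ⊓ N).starProjection_apply_mem v
  have hu := (M ⊓ N).sub_starProjection_mem_orthogonal v
  have hnorm : ‖v - (M ⊓ N).starProjection v‖ ≤ ‖v‖ := by
    rw [← Submodule.starProjection_orthogonal_val]
    exact (M ⊓ N)ᗮ.norm_starProjection_apply_le v
  have heq : ((M.starProjection ∘L N.starProjection) ^ (n + 1) - (M ⊓ N).starProjection) v =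
      ((M.starProjection ∘L N.starProjection) ^ (n + 1)) (v - (M ⊓ N).starProjection v) := by
    rw [map_sub, alternating_pow_apply_of_mem hw, sub_apply]
  rw [heq]
  exact (alternating_pow_succ_apply M N hu n).2.trans (by gcongr)
end

section
/- Let (c₁,…,c_d) be an orthonormal basis of ℝ^d, fix a partition d₁ + … + d_p = d with all d_i ≥ 1 and set s_i := d₁ + … + d_i. Then the set of d-tuples (b₁,…,b_d) ∈ (ℝ^d)^d that are not admissible with respect to (c) — i.e. the tuples that either are not a basis of ℝ^d or satisfy d(span(b₁,…,b_{s_i}), span(c₁,…,c_{s_i})) = 1 for some i < p — has Lebesgue measure zero in (ℝ^d)^d. -/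
open MeasureTheory Filter Submodule
open scoped RealInnerProductSpace

/-- The span of the first `k` vectors of the tuple `b`. -/
noncomputable def spanFirst {d : ℕ} (k : ℕ) (b : Fin d → Euc d) : Submodule ℝ (Euc d) :=
  Submodule.span ℝ (b '' {j : Fin d | (j : ℕ) < k})

section GramMatrix

variable {ι E : Type*} [Fintype ι] [DecidableEq ι] [NormedAddCommGroup E] [InnerProductSpace ℝ E]
  {u v : ι → E}

/-- If the mixed Gram matrix of `u` and `v` is invertible, a linear combination of `v` that is
orthogonal to every `u i` has zero coefficients. -/
lemma coeff_eq_zero_of_det_inner_ne_zero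
    (h : (Matrix.of fun i j => ⟪u i, v j⟫).det ≠ 0) {a : ι → ℝ}
    (ha : ∀ i, ⟪u i, ∑ j, a j • v j⟫ = 0) : a = 0 := by
  refine Matrix.eq_zero_of_mulVec_eq_zero h ?_
  ext i
  simpa [Matrix.mulVec, dotProduct, inner_sum, inner_smul_right, mul_comm] using ha i

lemma linearIndependent_of_det_inner_ne_zero
    (h : (Matrix.of fun i j => ⟪u i, v j⟫).det ≠ 0) : LinearIndependent ℝ v := by
  rw [Fintype.linearIndependent_iff]
  intro a ha i
  exact congrFun (coeff_eq_zero_of_det_inner_ne_zero h fun i => by rw [ha, inner_zero_right]) i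

lemma span_inf_orthogonal_eq_bot_of_det_inner_ne_zero
    (h : (Matrix.of fun i j => ⟪u i, v j⟫).det ≠ 0) :
    span ℝ (Set.range v) ⊓ (span ℝ (Set.range u))ᗮ = ⊥ := by
  rw [eq_bot_iff]
  rintro x ⟨hxv, hxu⟩
  obtain ⟨a, rfl⟩ := (Submodule.mem_span_range_iff_exists_fun ℝ).1 hxv
  have ha : a = 0 := coeff_eq_zero_of_det_inner_ne_zero h fun i =>
    (mem_orthogonal _ _).1 hxu _ (subset_span ⟨i, rfl⟩)
  simp [ha]

end GramMatrix

/-- On a finite-dimensional space, a continuous linear map that strictly contracts every nonzero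
vector does not have operator norm one. -/
lemma ContinuousLinearMap.norm_ne_one_of_norm_apply_lt {E F : Type*} [NormedAddCommGroup E]
    [NormedSpace ℝ E] [FiniteDimensional ℝ E] [NormedAddCommGroup F] [NormedSpace ℝ F]
    (T : E →L[ℝ] F) (h : ∀ x, x ≠ 0 → ‖T x‖ < ‖x‖) : ‖T‖ ≠ 1 := by
  have : ProperSpace E := FiniteDimensional.proper ℝ E
  obtain ⟨x, hx, hmax⟩ := (isCompact_closedBall (0 : E) 1).exists_sSup_image_eq
    ⟨0, by simp⟩ (f := fun x => ‖T x‖) (by fun_prop)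
  rw [T.sSup_unitClosedBall_eq_norm] at hmax
  rw [hmax]
  rw [mem_closedBall_zero_iff] at hx
  rcases eq_or_ne x 0 with rfl | hx0
  · simp
  · exact ((h x hx0).trans_le hx).ne

/-- The difference of two orthogonal projections strictly contracts every nonzero vector as soon
as neither subspace meets the orthogonal complement of the other. -/
lemma norm_starProjection_sub_apply_lt {E : Type*} [NormedAddCommGroup E]
    [InnerProductSpace ℝ E] {M N : Submodule ℝ E} [M.HasOrthogonalProjection]
    [N.HasOrthogonalProjection] (hMN : M ⊓ Nᗮ = ⊥) (hNM : N ⊓ Mᗮ = ⊥) {x : E} (hx : x ≠ 0) :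
    ‖M.starProjection x - N.starProjection x‖ < ‖x‖ := by
  have hsplit : x = N.starProjection x + Nᗮ.starProjection x :=
    (N.starProjection_add_starProjection_orthogonal x).symm
  set y := N.starProjection x
  set z := Nᗮ.starProjection x
  have hyN : y ∈ N := N.starProjection_apply_mem x
  have hzN : z ∈ Nᗮ := Nᗮ.starProjection_apply_mem x
  have hxn : ‖x‖ ^ 2 = ‖y‖ ^ 2 + ‖z‖ ^ 2 := N.norm_sq_eq_add_norm_sq_starProjection x
  have hyn := M.norm_sq_eq_add_norm_sq_starProjection y
  have hzn := M.norm_sq_eq_add_norm_sq_starProjection z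
  have hdiff : M.starProjection x - y = M.starProjection z - Mᗮ.starProjection y := by
    have := M.starProjection_add_starProjection_orthogonal y
    rw [hsplit, map_add, sub_eq_sub_iff_add_eq_add]
    nth_rewrite 3 [← this]
    abel
  have hdn : ‖M.starProjection x - y‖ ^ 2
      = ‖M.starProjection z‖ ^ 2 + ‖Mᗮ.starProjection y‖ ^ 2 := by
    have horth : ⟪M.starProjection z, Mᗮ.starProjection y⟫ = 0 :=
      (mem_orthogonal _ _).1 (Mᗮ.starProjection_apply_mem y) _ (M.starProjection_apply_mem z)
    rw [hdiff, norm_sub_sq_real, horth]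
    ring
  by_contra! hle
  have hle2 : ‖x‖ ^ 2 ≤ ‖M.starProjection x - y‖ ^ 2 := by gcongr
  have hy0 : y ∈ N ⊓ Mᗮ := by
    refine mem_inf.2 ⟨hyN, ?_⟩
    rw [← M.starProjection_apply_eq_zero_iff, ← norm_eq_zero, ← sq_eq_zero_iff]
    nlinarith [sq_nonneg ‖M.starProjection y‖, sq_nonneg ‖Mᗮ.starProjection z‖]
  have hz0 : z ∈ M ⊓ Nᗮ := by
    refine mem_inf.2 ⟨?_, hzN⟩
    rw [← M.orthogonal_orthogonal, ← Mᗮ.starProjection_apply_eq_zero_iff, ← norm_eq_zero,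
      ← sq_eq_zero_iff]
    nlinarith [sq_nonneg ‖M.starProjection y‖, sq_nonneg ‖Mᗮ.starProjection z‖]
  rw [hNM, Submodule.mem_bot] at hy0
  rw [hMN, Submodule.mem_bot] at hz0
  exact hx (by rw [hsplit, hy0, hz0, add_zero])

lemma ae_det_add_smul_one_ne_zero {ι : Type*} [Fintype ι] [DecidableEq ι] (A : Matrix ι ι ℝ) :
    ∀ᵐ t : ℝ, (A + t • (1 : Matrix ι ι ℝ)).det ≠ 0 := by
  have hfin : {t : ℝ | (-A).charpoly.IsRoot t}.Finite :=
    Polynomial.finite_setOfPred_isRoot (-A).charpoly_monic.ne_zero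
  filter_upwards [hfin.countable.ae_notMem volume] with t ht hdet
  refine ht ?_
  rw [Polynomial.IsRoot, Matrix.eval_charpoly, ← hdet, Matrix.scalar_apply,
    ← Matrix.smul_one_eq_diagonal, sub_neg_eq_add, add_comm]

/-- Almost every tuple has an invertible mixed Gram matrix with an orthonormal tuple. -/
lemma ae_det_inner_ne_zero {ι κ E : Type*} [Fintype ι] [DecidableEq ι] [Fintype κ]
    [NormedAddCommGroup E] [InnerProductSpace ℝ E] [FiniteDimensional ℝ E] [MeasurableSpace E]
    [BorelSpace E] {c : κ → E} (hc : Orthonormal ℝ c) {f : ι → κ} (hf : Function.Injective f) :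
    ∀ᵐ b : κ → E, (Matrix.of fun i j => ⟪c (f i), b (f j)⟫).det ≠ 0 := by
  have hcont : Continuous fun b : κ → E =>
      (Matrix.of fun i j => ⟪c (f i), b (f j)⟫).det := by
    refine Continuous.matrix_det (continuous_matrix fun i j => ?_)
    simp only [Matrix.of_apply]
    fun_prop
  refine ae_mem_of_ae_add_linearMap_mem (LinearMap.toSpanSingleton ℝ (κ → E) c) volume volume
    (s := {b | (Matrix.of fun i j => ⟪c (f i), b (f j)⟫).det ≠ 0})
    (isOpen_ne_fun hcont continuous_const).measurableSet fun b => ?_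
  filter_upwards [ae_det_add_smul_one_ne_zero (Matrix.of fun i j => ⟪c (f i), b (f j)⟫)]
    with t ht
  convert ht using 2
  ext i j
  have hij := orthonormal_iff_ite.1 (hc.comp f hf) i j
  rw [Function.comp_apply, Function.comp_apply] at hij
  simp [inner_add_right, inner_smul_right, hij, Matrix.one_apply]

lemma spanFirst_eq_span_range {d : ℕ} (k : ℕ) (b : Fin d → Euc d) :
    spanFirst k b = span ℝ (Set.range fun j : {j : Fin d // (j : ℕ) < k} => b j) := by
  rw [spanFirst, Set.image_eq_range]
  rfl

lemma subDist_spanFirst_ne_one {d k : ℕ} {b c : Fin d → Euc d}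
    (h : (Matrix.of fun i j : {j : Fin d // (j : ℕ) < k} => ⟪c i, b j⟫).det ≠ 0) :
    subDist (spanFirst k b) (spanFirst k c) ≠ 1 := by
  have h' : (Matrix.of fun i j : {j : Fin d // (j : ℕ) < k} => ⟪b i, c j⟫).det ≠ 0 := by
    rw [← Matrix.det_transpose]
    convert h using 2
    ext i j
    exact real_inner_comm (c i) (b j)
  refine ContinuousLinearMap.norm_ne_one_of_norm_apply_lt _ fun x hx => ?_
  rw [spanFirst_eq_span_range, spanFirst_eq_span_range]
  exact norm_starProjection_sub_apply_lt (span_inf_orthogonal_eq_bot_of_det_inner_ne_zero h)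
    (span_inf_orthogonal_eq_bot_of_det_inner_ne_zero h') hx

/-- The set of tuples that are not admissible with respect to the orthonormal basis `c`
(given a partition of `d` with partial sums `s`) has Lebesgue measure zero. -/
theorem nonadmissible_measure_zero (d p : ℕ) (c : OrthonormalBasis (Fin d) ℝ (Euc d))
    (s : ℕ → ℕ) (hs0 : s 0 = 0) (hsp : s p = d) (hmono : StrictMonoOn s (Set.Iic p)) :
    volume {b : Fin d → Euc d |
      ¬ (LinearIndependent ℝ b ∧ Submodule.span ℝ (Set.range b) = ⊤) ∨
      ∃ i, 0 < i ∧ i < p ∧ subDist (spanFirst (s i) b) (spanFirst (s i) ⇑c) = 1} = 0 := by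
  have hbasis : ∀ᵐ b : Fin d → Euc d, (Matrix.of fun i j => ⟪c i, b j⟫).det ≠ 0 :=
    ae_det_inner_ne_zero c.orthonormal Function.injective_id
  have hminors : ∀ᵐ b : Fin d → Euc d, ∀ k : ℕ,
      (Matrix.of fun i j : {j : Fin d // (j : ℕ) < k} => ⟪c i, b j⟫).det ≠ 0 :=
    ae_all_iff.2 fun k => ae_det_inner_ne_zero c.orthonormal Subtype.val_injective
  refine measure_mono_null ?_ (ae_iff.1 (hbasis.and hminors))
  rintro b hb ⟨hdet, hmin⟩
  rcases hb with hb | ⟨i, -, -, hi⟩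
  · have hli := linearIndependent_of_det_inner_ne_zero hdet
    exact hb ⟨hli, hli.span_eq_top_of_card_eq_finrank' (by simp)⟩
  · exact subDist_spanFirst_ne_one (hmin (s i)) hi
end
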